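/- arXiv:2310.10869 — 3 statements merged into one kernel-verified Lean document; each statement's English description precedes it below -/
import Mathlib

section
/- Let σ be an absolutely continuous probability measure on ℝⁿ with finite second moment, let μ be a probability measure on ℝⁿ with finite second moment, let P = [θ₁, …, θₙ] ∈ O(n), let f₁, …, fₙ : ℝ → ℝ be nondecreasing, and set T(x) = Σᵢ₌₁ⁿ fᵢ(⟨x, θᵢ⟩) θᵢ. Let T₀ : ℝⁿ → ℝⁿ be any map with (T₀)_♯σ = μ. Then T = T₀ pointwise if and only if ⟨T₀(x), θᵢ⟩ = fᵢ(⟨x, θᵢ⟩) for every i = 1, …, n and every x ∈ ℝⁿ. Moreover, if these equivalent conditions hold, then (fᵢ)_♯σ^{θᵢ} = μ^{θᵢ} for each i, fᵢ = T_{σ^{θᵢ}}^{μ^{θᵢ}} holds σ^{θᵢ}-almost everywhere, and T coincides σ-almost everywhere with the matrix-slice matching map T_{σ,μ;P}. -/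
open MeasureTheory Filter
open scoped ENNReal RealInnerProductSpace BigOperators Topology

noncomputable section

namespace SliceMatching

/-- `ℝⁿ` with its Euclidean structure. -/
abbrev Rn (n : ℕ) := EuclideanSpace ℝ (Fin n)

/-- The cumulative distribution function of a measure on `ℝ`. -/
def cdf (ν : Measure ℝ) (t : ℝ) : ℝ := (ν (Set.Iic t)).toReal

/-- The quantile function (pseudo-inverse of the CDF) of a measure on `ℝ`. -/
def quantile (ρ : Measure ℝ) (p : ℝ) : ℝ := sInf {t : ℝ | p ≤ cdf ρ t}

/-- The one-dimensional optimal transport map `T_ν^ρ = F_ρ⁻¹ ∘ F_ν`. -/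
def otMap1d (ν ρ : Measure ℝ) (t : ℝ) : ℝ := quantile ρ (cdf ν t)

/-- The slice `σ^θ`: pushforward of `σ` under the projection `x ↦ ⟪x, θ⟫`. -/
def slice {n : ℕ} (σ : Measure (Rn n)) (θ : Rn n) : Measure ℝ :=
  σ.map (fun x => ⟪x, θ⟫)

/-- The matrix-slice matching map `T_{σ,μ;P}`, where `P ∈ O(n)` has columns `θ 0, …, θ (n-1)`:
`T_{σ,μ;P}(x) = ∑ i, T_{σ^{θ i}}^{μ^{θ i}}(⟪x, θ i⟫) • θ i`. -/
def smMap {n : ℕ} (σ μ : Measure (Rn n)) (θ : Fin n → Rn n) (x : Rn n) : Rn n :=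
  ∑ i, otMap1d (slice σ (θ i)) (slice μ (θ i)) ⟪x, θ i⟫ • θ i

/-- The squared quadratic Wasserstein distance: the infimum of `∫ ‖x - y‖²` over all
couplings of `σ` and `μ`. -/
def W2sq {α : Type*} [MeasurableSpace α] [NormedAddCommGroup α] (σ μ : Measure α) : ℝ :=
  (⨅ (π : Measure (α × α)) (_ : π.map Prod.fst = σ ∧ π.map Prod.snd = μ),
    ∫⁻ p, ENNReal.ofReal (‖p.1 - p.2‖ ^ 2) ∂π).toReal

/-- The quadratic Wasserstein distance `W₂`. -/
def W2 {α : Type*} [MeasurableSpace α] [NormedAddCommGroup α] (σ μ : Measure α) : ℝ :=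
  Real.sqrt (W2sq σ μ)

/-- A set all of whose initial segments are null is null. -/
theorem measure_null_of_forall_inter_Iic {ν : Measure ℝ} {B : Set ℝ}
    (h : ∀ t ∈ B, ν (B ∩ Set.Iic t) = 0) : ν B = 0 := by
  by_cases hmax : ∃ t ∈ B, ∀ s ∈ B, s ≤ t
  · obtain ⟨t, ht, hle⟩ := hmax
    exact measure_mono_null (Set.subset_inter subset_rfl hle) (h t ht)
  · push Not at hmax
    refine measure_null_of_locally_null B fun s hs => ?_
    obtain ⟨t, ht, hst⟩ := hmax s hs
    exact ⟨B ∩ Set.Iic t, inter_mem_nhdsWithin B (Iic_mem_nhds hst), h t ht⟩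

/-- A nondecreasing map is almost everywhere equal to the one-dimensional optimal transport map
onto its own pushforward. -/
theorem ae_eq_otMap1d_map (ν : Measure ℝ) [IsProbabilityMeasure ν] {f : ℝ → ℝ}
    (hf : Monotone f) : f =ᵐ[ν] otMap1d ν (ν.map f) := by
  have hcdf (y : ℝ) : cdf (ν.map f) y = ν.real {s | f s ≤ y} := by
    rw [cdf, Measure.map_apply hf.measurable measurableSet_Iic]
    rfl
  have hnull (q : ℚ) : ν {t | (q : ℝ) < f t ∧ ν.real (Set.Iic t) ≤ ν.real {s | f s ≤ q}} = 0 := by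
    refine measure_null_of_forall_inter_Iic fun t ht => ?_
    have hsub : {s | f s ≤ q} ⊆ Set.Iic t := fun s hs =>
      le_of_lt (hf.reflect_lt (lt_of_le_of_lt hs ht.1))
    refine measure_mono_null (t := Set.Iic t \ {s | f s ≤ q})
      (fun s hs => ⟨hs.2, not_le.2 hs.1.1⟩) ?_
    rw [← measureReal_eq_zero_iff,
      measureReal_sdiff hsub (measurableSet_le hf.measurable measurable_const)]
    exact le_antisymm (sub_nonpos.2 ht.2) (sub_nonneg.2 (measureReal_mono hsub))
  have hall : ∀ᵐ t ∂ν, ∀ q : ℚ,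
      ¬ ((q : ℝ) < f t ∧ ν.real (Set.Iic t) ≤ ν.real {s | f s ≤ q}) :=
    ae_all_iff.2 fun q => measure_eq_zero_iff_ae_notMem.1 (hnull q)
  filter_upwards [hall] with t ht
  have hleast : IsLeast {y : ℝ | cdf ν t ≤ cdf (ν.map f) y} (f t) := by
    refine ⟨?_, fun y hy => ?_⟩
    · rw [Set.mem_ofPred_eq, hcdf]
      exact measureReal_mono fun s hs => hf hs
    · by_contra! hlt
      obtain ⟨q, hyq, hqt⟩ := exists_rat_btwn hlt
      rw [Set.mem_ofPred_eq, hcdf] at hy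
      exact ht q ⟨hqt, hy.trans (measureReal_mono fun s hs => le_trans hs hyq.le)⟩
  exact hleast.csInf_eq.symm

/-- An orthonormal family of `n` vectors in `ℝⁿ` expands every vector. -/
theorem sum_inner_smul_eq {n : ℕ} {θ : Fin n → Rn n} (hθ : Orthonormal ℝ θ) (x : Rn n) :
    ∑ i, ⟪x, θ i⟫ • θ i = x := by
  have hspan := hθ.linearIndependent.span_eq_top_of_card_eq_finrank' (by simp)
  have := (OrthonormalBasis.mk hθ hspan.ge).sum_repr' x
  simpa [real_inner_comm] using this

/-- Characterization of when a pushforward map coincides with a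
`P`-compatible map, and identification with the matrix-slice matching map. -/
theorem stmt0 {n : ℕ}
    (σ μ : Measure (Rn n)) [IsProbabilityMeasure σ] [IsProbabilityMeasure μ]
    (hac : σ ≪ volume)
    (hσ2 : Integrable (fun x => ‖x‖ ^ 2) σ) (hμ2 : Integrable (fun y => ‖y‖ ^ 2) μ)
    (θ : Fin n → Rn n) (hθ : Orthonormal ℝ θ)
    (f : Fin n → ℝ → ℝ) (hf : ∀ i, Monotone (f i))
    (T : Rn n → Rn n) (hT : ∀ x, T x = ∑ i, f i ⟪x, θ i⟫ • θ i)
    (T₀ : Rn n → Rn n) (hT₀ : σ.map T₀ = μ) :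
    ((∀ x, T x = T₀ x) ↔ ∀ i x, ⟪T₀ x, θ i⟫ = f i ⟪x, θ i⟫) ∧
    ((∀ x, T x = T₀ x) →
      (∀ i, (slice σ (θ i)).map (f i) = slice μ (θ i)) ∧
      (∀ i, f i =ᵐ[slice σ (θ i)] otMap1d (slice σ (θ i)) (slice μ (θ i))) ∧
      T =ᵐ[σ] smMap σ μ θ) := by
  have hcoord (i : Fin n) (x : Rn n) : ⟪T x, θ i⟫ = f i ⟪x, θ i⟫ := by
    rw [hT, hθ.inner_left_fintype]
    simp
  refine ⟨⟨fun h i x => by rw [← h, hcoord], fun h x => ?_⟩, fun h => ?_⟩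
  · rw [hT, ← sum_inner_smul_eq hθ (T₀ x)]
    simp only [h]
  have hproj (i : Fin n) : Measurable fun x : Rn n => ⟪x, θ i⟫ := by fun_prop
  have hTm : Measurable T := by
    rw [funext hT]
    exact Finset.measurable_fun_sum _ fun i _ =>
      ((hf i).measurable.comp (hproj i)).smul_const (θ i)
  have hpush (i : Fin n) : (slice σ (θ i)).map (f i) = slice μ (θ i) := by
    rw [← hT₀, ← funext h, slice, slice, Measure.map_map (hf i).measurable (hproj i),
      Measure.map_map (hproj i) hTm]
    exact congrArg (Measure.map · σ) (funext fun x => (hcoord i x).symm)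
  have hot (i : Fin n) : f i =ᵐ[slice σ (θ i)] otMap1d (slice σ (θ i)) (slice μ (θ i)) := by
    have : IsProbabilityMeasure (slice σ (θ i)) :=
      Measure.isProbabilityMeasure_map (hproj i).aemeasurable
    rw [← hpush i]
    exact ae_eq_otMap1d_map _ (hf i)
  refine ⟨hpush, hot, ?_⟩
  filter_upwards [ae_all_iff.2 fun i => ae_of_ae_map (hproj i).aemeasurable (hot i)] with x hx
  rw [hT, smMap]
  exact Finset.sum_congr rfl fun i _ => by rw [hx i]

end SliceMatching
end
end

section
/- Let σ be an absolutely continuous probability measure on ℝⁿ with finite second moment, μ a probability measure on ℝⁿ with finite second moment, and P ∈ O(n). Then ∫ T_{σ,μ;P}(x) dσ(x) = ∫ y dμ(y) and ∫ ‖T_{σ,μ;P}(x)‖² dσ(x) = ∫ ‖y‖² dμ(y); that is, the pushforward measure (T_{σ,μ;P})_♯σ has the same mean and the same second moment as μ. -/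
open MeasureTheory Filter
open scoped ENNReal RealInnerProductSpace BigOperators Topology

noncomputable section

namespace SliceMatching

lemma cdf_eq_stieltjes (ν : Measure ℝ) [IsProbabilityMeasure ν] (t : ℝ) :
    cdf ν t = ProbabilityTheory.cdf ν t := by
  rw [ProbabilityTheory.cdf_eq_real]; rfl

lemma monotone_cdf (ν : Measure ℝ) [IsProbabilityMeasure ν] : Monotone (cdf ν) := by
  intro a b h
  simpa only [cdf_eq_stieltjes] using ProbabilityTheory.monotone_cdf ν h

lemma cdf_nonneg (ν : Measure ℝ) (t : ℝ) : 0 ≤ cdf ν t := ENNReal.toReal_nonneg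

lemma cdf_le_one (ν : Measure ℝ) [IsProbabilityMeasure ν] (t : ℝ) : cdf ν t ≤ 1 := by
  rw [cdf_eq_stieltjes]; exact ProbabilityTheory.cdf_le_one ν t

lemma ofReal_cdf (ν : Measure ℝ) [IsProbabilityMeasure ν] (t : ℝ) :
    ENNReal.ofReal (cdf ν t) = ν (Set.Iic t) := by
  rw [cdf_eq_stieltjes]; exact ProbabilityTheory.ofReal_cdf ν t

lemma tendsto_cdf_atTop (ν : Measure ℝ) [IsProbabilityMeasure ν] :
    Tendsto (cdf ν) atTop (𝓝 1) := by
  rw [funext (cdf_eq_stieltjes ν)]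
  exact ProbabilityTheory.tendsto_cdf_atTop ν

lemma tendsto_cdf_atBot (ν : Measure ℝ) [IsProbabilityMeasure ν] :
    Tendsto (cdf ν) atBot (𝓝 0) := by
  rw [funext (cdf_eq_stieltjes ν)]
  exact ProbabilityTheory.tendsto_cdf_atBot ν

lemma continuous_cdf (ν : Measure ℝ) [IsProbabilityMeasure ν] [NullSingletonClass ν] :
    Continuous (cdf ν) := by
  rw [funext (cdf_eq_stieltjes ν), continuous_iff_continuousAt]
  intro x
  rw [(ProbabilityTheory.monotone_cdf ν).continuousAt_iff_leftLim_eq_rightLim,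
    StieltjesFunction.rightLim_eq]
  have h := (ProbabilityTheory.cdf ν).measure_singleton x
  rw [ProbabilityTheory.measure_cdf, measure_singleton, eq_comm, ENNReal.ofReal_eq_zero] at h
  have := (ProbabilityTheory.monotone_cdf ν).leftLim_le (le_refl x)
  linarith

/-- The quantile function and the CDF form a Galois connection on `(0, 1)`. -/
lemma quantile_le_iff (ρ : Measure ℝ) [IsProbabilityMeasure ρ] {p : ℝ} (hp : p ∈ Set.Ioo 0 1)
    (a : ℝ) : quantile ρ p ≤ a ↔ p ≤ cdf ρ a := by
  have hne : {t : ℝ | p ≤ cdf ρ t}.Nonempty :=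
    ((tendsto_cdf_atTop ρ).eventually (eventually_ge_nhds hp.2)).exists
  have hbdd : BddBelow {t : ℝ | p ≤ cdf ρ t} := by
    obtain ⟨b, hb⟩ := ((tendsto_cdf_atBot ρ).eventually (eventually_lt_nhds hp.1)).exists
    refine ⟨b, fun t ht => ?_⟩
    by_contra! hlt
    exact absurd (ht.trans (monotone_cdf ρ hlt.le)) (not_le.mpr hb)
  refine ⟨fun h => ?_, fun h => csInf_le hbdd h⟩
  have hright : Tendsto (cdf ρ) (𝓝[>] a) (𝓝 (cdf ρ a)) := by
    rw [funext (cdf_eq_stieltjes ρ)]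
    exact ((ProbabilityTheory.cdf ρ).right_continuous a).mono Set.Ioi_subset_Ici_self
  refine ge_of_tendsto hright ?_
  filter_upwards [self_mem_nhdsWithin] with b hb
  obtain ⟨t, ht, htb⟩ := exists_lt_of_csInf_lt hne (lt_of_le_of_lt h hb)
  exact le_trans ht (monotone_cdf ρ htb.le)

lemma monotoneOn_quantile (ρ : Measure ℝ) [IsProbabilityMeasure ρ] :
    MonotoneOn (quantile ρ) (Set.Ioo 0 1) := fun _ hp _ hq hpq =>
  (quantile_le_iff ρ hp _).2 (hpq.trans ((quantile_le_iff ρ hq _).1 le_rfl))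

lemma measure_cdf_le_of_mem_Ioo (ν : Measure ℝ) [IsProbabilityMeasure ν] [NullSingletonClass ν] {p : ℝ}
    (hp : p ∈ Set.Ioo 0 1) : ν {t | cdf ν t ≤ p} = ENNReal.ofReal p := by
  have hne : {t | cdf ν t ≤ p}.Nonempty :=
    ((tendsto_cdf_atBot ν).eventually (eventually_le_nhds hp.1)).exists
  obtain ⟨b, hb⟩ := ((tendsto_cdf_atTop ν).eventually (eventually_gt_nhds hp.2)).exists
  have hbdd : ∀ t, cdf ν t ≤ p → t ≤ b := fun t ht => by
    by_contra! hlt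
    exact absurd ((monotone_cdf ν hlt.le).trans ht) (not_le.mpr hb)
  have hbdd' : BddAbove {t | cdf ν t ≤ p} := ⟨b, hbdd⟩
  have hc : cdf ν (sSup {t | cdf ν t ≤ p}) ≤ p :=
    (isClosed_le (continuous_cdf ν) continuous_const).csSup_mem hne hbdd'
  obtain ⟨s, hs', hs⟩ := intermediate_value_Icc (hbdd _ hc) (continuous_cdf ν).continuousOn
    ⟨hc, hb.le⟩
  have hset : {t | cdf ν t ≤ p} = Set.Iic s := by
    ext t
    exact ⟨fun ht => (le_csSup hbdd' ht).trans hs'.1, fun ht => (monotone_cdf ν ht).trans hs.le⟩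
  rw [hset, ← ofReal_cdf, hs]

/-- The CDF of an atomless distribution is uniformly distributed under that distribution. -/
lemma measure_cdf_le (ν : Measure ℝ) [IsProbabilityMeasure ν] [NullSingletonClass ν] {p : ℝ}
    (hp : p ∈ Set.Icc 0 1) : ν {t | cdf ν t ≤ p} = ENNReal.ofReal p := by
  rcases hp.2.eq_or_lt with rfl | hp1
  · simp [cdf_le_one]
  rcases hp.1.eq_or_lt with rfl | hp0
  · rw [ENNReal.ofReal_zero, ← nonpos_iff_eq_zero]
    have hlim : Tendsto (fun q : ℝ => ENNReal.ofReal q) (𝓝[>] 0) (𝓝 0) := by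
      simpa using (ENNReal.continuous_ofReal.tendsto 0).mono_left nhdsWithin_le_nhds
    refine ge_of_tendsto hlim ?_
    filter_upwards [Ioo_mem_nhdsGT (zero_lt_one' ℝ)] with q hq
    rw [← measure_cdf_le_of_mem_Ioo ν hq]
    exact measure_mono fun t ht => le_trans ht hq.1.le
  · exact measure_cdf_le_of_mem_Ioo ν ⟨hp0, hp1⟩

lemma ae_cdf_mem_Ioo (ν : Measure ℝ) [IsProbabilityMeasure ν] [NullSingletonClass ν] :
    ∀ᵐ t ∂ν, cdf ν t ∈ Set.Ioo (0 : ℝ) 1 := by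
  have h0 : ∀ᵐ t ∂ν, 0 < cdf ν t := by
    simpa [ae_iff] using measure_cdf_le ν (p := 0) (by simp)
  have h1 : ∀ᵐ t ∂ν, cdf ν t < 1 := by
    rw [ae_iff, ← nonpos_iff_eq_zero]
    have hlim : Tendsto (fun q : ℝ => 1 - ENNReal.ofReal q) (𝓝[<] 1) (𝓝 0) := by
      have h : Tendsto (fun q : ℝ => ENNReal.ofReal q) (𝓝[<] 1) (𝓝 1) := by
        simpa using (ENNReal.continuous_ofReal.tendsto 1).mono_left nhdsWithin_le_nhds
      simpa using ENNReal.Tendsto.sub tendsto_const_nhds h (Or.inl ENNReal.one_ne_top)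
    refine ge_of_tendsto hlim ?_
    filter_upwards [Ioo_mem_nhdsLT (zero_lt_one' ℝ)] with q hq
    rw [← measure_cdf_le_of_mem_Ioo ν hq, ← prob_compl_eq_one_sub
      (measurableSet_le (monotone_cdf ν).measurable measurable_const)]
    refine measure_mono fun t ht => ?_
    simp only [Set.mem_ofPred_eq, not_lt, Set.mem_compl_iff, not_le] at ht ⊢
    exact hq.2.trans_le ht
  filter_upwards [h0, h1] with t ht0 ht1 using ⟨ht0, ht1⟩

lemma aemeasurable_otMap1d (ν ρ : Measure ℝ) [IsProbabilityMeasure ν] [NullSingletonClass ν]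
    [IsProbabilityMeasure ρ] : AEMeasurable (otMap1d ν ρ) ν := by
  have hF : AEMeasurable (cdf ν) ν := (monotone_cdf ν).measurable.aemeasurable
  have hq : AEMeasurable (quantile ρ) (ν.map (cdf ν)) := by
    have h : ∀ᵐ p ∂(ν.map (cdf ν)), p ∈ Set.Ioo (0 : ℝ) 1 :=
      (ae_map_iff hF measurableSet_Ioo).2 (ae_cdf_mem_Ioo ν)
    rw [← Measure.restrict_eq_self_of_ae_mem h]
    exact aemeasurable_restrict_of_monotoneOn measurableSet_Ioo (monotoneOn_quantile ρ)
  exact hq.comp_aemeasurable hF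

/-- The one-dimensional optimal transport map pushes `ν` forward to `ρ`. -/
lemma map_otMap1d (ν ρ : Measure ℝ) [IsProbabilityMeasure ν] [NullSingletonClass ν]
    [IsProbabilityMeasure ρ] : ν.map (otMap1d ν ρ) = ρ := by
  have hT := aemeasurable_otMap1d ν ρ
  refine Measure.ext_of_Iic _ _ fun a => ?_
  rw [Measure.map_apply_of_aemeasurable hT measurableSet_Iic, ← ofReal_cdf ρ a,
    ← measure_cdf_le ν ⟨cdf_nonneg ρ a, cdf_le_one ρ a⟩]
  refine measure_congr ?_
  filter_upwards [ae_cdf_mem_Ioo ν] with t ht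
  exact propext (quantile_le_iff ρ ht a)

lemma measurable_inner_const {n : ℕ} (θ : Rn n) : Measurable fun x : Rn n => ⟪x, θ⟫ := by
  fun_prop

instance isProbabilityMeasure_slice {n : ℕ} (σ : Measure (Rn n)) [IsProbabilityMeasure σ]
    (θ : Rn n) : IsProbabilityMeasure (slice σ θ) :=
  Measure.isProbabilityMeasure_map (measurable_inner_const θ).aemeasurable

lemma noAtoms_slice {n : ℕ} {σ : Measure (Rn n)} (hac : σ ≪ volume) {θ : Rn n} (hθ : θ ≠ 0) :
    NullSingletonClass (slice σ θ) := by
  refine ⟨fun t => ?_⟩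
  rw [slice, Measure.map_apply (measurable_inner_const θ) (measurableSet_singleton t)]
  refine hac ?_
  obtain ⟨c, -, hc⟩ := (innerₛₗ ℝ θ).exists_map_addHaar_eq_smul_addHaar
    (volume : Measure (Rn n)) (volume : Measure ℝ)
    (LinearMap.surjective fun h => hθ (by simpa using LinearMap.congr_fun h θ))
  have h : (volume.map fun x : Rn n => ⟪x, θ⟫) = c • (volume : Measure ℝ) := by
    rw [← hc]
    congr 1
    ext x
    simp [real_inner_comm]
  rw [← Measure.map_apply (measurable_inner_const θ) (measurableSet_singleton t), h]
  simp

/-- The coordinate of the slice matching map along `θ` has the slice `μ^θ` as its law. -/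
lemma map_otMap1d_inner {n : ℕ} {σ μ : Measure (Rn n)} [IsProbabilityMeasure σ]
    [IsProbabilityMeasure μ] (hac : σ ≪ volume) {θ : Rn n} (hθ : θ ≠ 0) :
    AEMeasurable (fun x => otMap1d (slice σ θ) (slice μ θ) ⟪x, θ⟫) σ ∧
      σ.map (fun x => otMap1d (slice σ θ) (slice μ θ) ⟪x, θ⟫) = slice μ θ := by
  have := noAtoms_slice hac hθ
  have hT : AEMeasurable (otMap1d (slice σ θ) (slice μ θ)) (σ.map fun x => ⟪x, θ⟫) :=
    aemeasurable_otMap1d (slice σ θ) (slice μ θ)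
  have hm := (measurable_inner_const θ).aemeasurable (μ := σ)
  refine ⟨hT.comp_aemeasurable hm, ?_⟩
  exact (AEMeasurable.map_map_of_aemeasurable hT hm).symm.trans
    (map_otMap1d (slice σ θ) (slice μ θ))

/-- Each coordinate of the slice matching map under `σ` is distributed as that of `μ`. -/
lemma identDistrib_otMap1d_inner {n : ℕ} {σ μ : Measure (Rn n)} [IsProbabilityMeasure σ]
    [IsProbabilityMeasure μ] (hac : σ ≪ volume) {θ : Rn n} (hθ : θ ≠ 0) :
    ProbabilityTheory.IdentDistrib (fun x => otMap1d (slice σ θ) (slice μ θ) ⟪x, θ⟫)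
      (fun y => ⟪y, θ⟫) σ μ :=
  ⟨(map_otMap1d_inner hac hθ).1, (measurable_inner_const θ).aemeasurable,
    (map_otMap1d_inner hac hθ).2⟩

/-- Moment matching: one step of matrix-slice matching matches the mean
and the second moment of the target measure. -/
theorem stmt1 {n : ℕ}
    (σ μ : Measure (Rn n)) [IsProbabilityMeasure σ] [IsProbabilityMeasure μ]
    (hac : σ ≪ volume)
    (hσ2 : Integrable (fun x => ‖x‖ ^ 2) σ) (hμ2 : Integrable (fun y => ‖y‖ ^ 2) μ)
    (θ : Fin n → Rn n) (hθ : Orthonormal ℝ θ) :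
    (∫ x, smMap σ μ θ x ∂σ = ∫ y, y ∂μ) ∧
    (∫ x, ‖smMap σ μ θ x‖ ^ 2 ∂σ = ∫ y, ‖y‖ ^ 2 ∂μ) ∧
    (∫ y, y ∂(σ.map (smMap σ μ θ)) = ∫ y, y ∂μ) ∧
    (∫ y, ‖y‖ ^ 2 ∂(σ.map (smMap σ μ θ)) = ∫ y, ‖y‖ ^ 2 ∂μ) := by
  have hne (i : Fin n) : θ i ≠ 0 := hθ.ne_zero i
  have hid (i : Fin n) := identDistrib_otMap1d_inner (μ := μ) hac (hne i)
  let b : OrthonormalBasis (Fin n) ℝ (Rn n) := OrthonormalBasis.mk hθ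
    (hθ.linearIndependent.span_eq_top_of_card_eq_finrank' (by simp)).ge
  have hb (i : Fin n) : b i = θ i := by simp [b]
  have hsum (y : Rn n) : ∑ i, ⟪y, θ i⟫ • θ i = y := by
    simpa [hb, real_inner_comm] using b.sum_repr' y
  have hsq (y : Rn n) : ∑ i, ⟪y, θ i⟫ ^ 2 = ‖y‖ ^ 2 := by
    simpa [hb] using b.sum_sq_inner_left y
  have hLp : MemLp (fun y : Rn n => y) 2 μ :=
    (memLp_two_iff_integrable_sq_norm aestronglyMeasurable_id).2 hμ2
  have hLpi (i : Fin n) : MemLp (fun y : Rn n => ⟪y, θ i⟫) 2 μ := hLp.inner_const (θ i)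
  have hmeas : AEMeasurable (smMap σ μ θ) σ :=
    Finset.aemeasurable_fun_sum _ fun i _ => (hid i).aemeasurable_fst.smul_const (θ i)
  have hmean : ∫ x, smMap σ μ θ x ∂σ = ∫ y, y ∂μ := by
    have hint (i : Fin n) : Integrable (fun y : Rn n => ⟪y, θ i⟫) μ :=
      (hLpi i).integrable one_le_two
    calc ∫ x, smMap σ μ θ x ∂σ = ∑ i, (∫ y, ⟪y, θ i⟫ ∂μ) • θ i := by
          simp only [smMap]
          rw [integral_finsetSum _ fun i _ => ((hid i).integrable_iff.2 (hint i)).smul_const _]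
          exact Finset.sum_congr rfl fun i _ => by rw [integral_smul_const, (hid i).integral_eq]
      _ = ∫ y, ∑ i, ⟪y, θ i⟫ • θ i ∂μ := by
          rw [integral_finsetSum _ fun i _ => (hint i).smul_const _]
          exact Finset.sum_congr rfl fun i _ => (integral_smul_const _ _).symm
      _ = ∫ y, y ∂μ := by simp only [hsum]
  have hmom : ∫ x, ‖smMap σ μ θ x‖ ^ 2 ∂σ = ∫ y, ‖y‖ ^ 2 ∂μ := by
    have hnorm (x : Rn n) : ‖smMap σ μ θ x‖ ^ 2 =
        ∑ i, otMap1d (slice σ (θ i)) (slice μ (θ i)) ⟪x, θ i⟫ ^ 2 := by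
      rw [← hsq]
      exact Finset.sum_congr rfl fun i _ => by rw [smMap, real_inner_comm, hθ.inner_right_fintype]
    have hint (i : Fin n) : Integrable (fun y : Rn n => ⟪y, θ i⟫ ^ 2) μ := (hLpi i).integrable_sq
    simp only [hnorm, ← hsq]
    rw [integral_finsetSum _ fun i _ => (hid i).sq.integrable_iff.2 (hint i),
      integral_finsetSum _ fun i _ => hint i]
    exact Finset.sum_congr rfl fun i _ => (hid i).sq.integral_eq
  refine ⟨hmean, hmom, ?_, ?_⟩
  · exact (integral_map hmeas aestronglyMeasurable_id).trans hmean
  · rw [integral_map hmeas (by fun_prop), hmom]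

end SliceMatching
end
end

section
/- Let σ be an absolutely continuous probability measure on ℝⁿ with finite second moment, let P = [θ₁, …, θₙ] ∈ O(n), let T ∈ 𝔖(P) be a P-compatible map, and assume μ := T_♯σ has finite second moment. Then T_{σ,μ;P} = T holds σ-almost everywhere, and (T_{σ,μ;P})_♯σ = μ. -/
open MeasureTheory Filter
open scoped ENNReal RealInnerProductSpace BigOperators Topology

noncomputable section

namespace SliceMatching

/-- Almost every point `t` charges every left neighbourhood `(a, t]`. -/
theorem ae_forall_lt_measure_Ioc_ne_zero (ν : Measure ℝ) :
    ∀ᵐ t ∂ν, ∀ a < t, ν (Set.Ioc a t) ≠ 0 := by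
  have key : ∀ q : ℚ, ∀ᵐ t ∂ν, (q : ℝ) < t → ν (Set.Ioc (q : ℝ) t) ≠ 0 := by
    intro q
    rw [ae_iff]
    refine measure_null_of_locally_null _ fun x hx => ?_
    simp only [ne_eq, Classical.not_imp, not_not, Set.mem_ofPred_eq] at hx
    by_cases h : ∃ y, x < y ∧ ν (Set.Ioc (q : ℝ) y) = 0
    · obtain ⟨y, hxy, hy⟩ := h
      refine ⟨Set.Ioc q y, mem_nhdsWithin_of_mem_nhds ?_, hy⟩
      exact mem_of_superset (Ioo_mem_nhds hx.1 hxy) Set.Ioo_subset_Ioc_self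
    · push Not at h
      refine ⟨Set.Ioc q x, ?_, hx.2⟩
      refine mem_of_superset self_mem_nhdsWithin fun z hz => ?_
      simp only [ne_eq, Classical.not_imp, not_not, Set.mem_ofPred_eq] at hz
      exact ⟨hz.1, le_of_not_gt fun hxz => h z hxz hz.2⟩
  filter_upwards [ae_all_iff.2 key] with t ht a hat h0
  obtain ⟨q, haq, hqt⟩ := exists_rat_btwn hat
  exact ht q hqt (measure_mono_null (Set.Ioc_subset_Ioc_left haq.le) h0)

/-- A monotone map is the optimal transport map onto its own pushforward. -/
theorem otMap1d_map_ae_eq (ν : Measure ℝ) [IsFiniteMeasure ν] [NullSingletonClass ν]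
    {g : ℝ → ℝ} (hg : Monotone g) : otMap1d ν (ν.map g) =ᵐ[ν] g := by
  have hcont : ∀ᵐ t ∂ν, ContinuousAt g t := by
    rw [ae_iff]
    exact hg.countable_not_continuousAt.measure_zero ν
  filter_upwards [hcont, ae_forall_lt_measure_Ioc_ne_zero ν] with t hc hpos
  have hcdf : ∀ s, cdf ν t ≤ cdf (ν.map g) s ↔ ν (Set.Iic t) ≤ ν (g ⁻¹' Set.Iic s) := by
    intro s
    rw [cdf, cdf, Measure.map_apply hg.measurable measurableSet_Iic,
      ENNReal.toReal_le_toReal (measure_ne_top _ _) (measure_ne_top _ _)]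
  refine IsLeast.csInf_eq ⟨(hcdf _).2 (measure_mono fun x hx => hg hx), fun s hs => ?_⟩
  by_contra! hlt
  have hev : ∀ᶠ a in 𝓝[<] t, s < g a :=
    (hc.tendsto.mono_left nhdsWithin_le_nhds).eventually (lt_mem_nhds hlt)
  obtain ⟨a, hsa, hat : a < t⟩ := (hev.and self_mem_nhdsWithin).exists
  have hle : ν (Set.Iic t) ≤ ν (Set.Iic a) := ((hcdf s).1 hs).trans <|
    measure_mono fun x hx => le_of_not_gt fun hax => (hsa.trans_le (hg hax.le)).not_ge hx
  refine hpos a hat ?_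
  have hdiff : Set.Ioc a t = Set.Iic t \ Set.Iic a := by
    ext x
    simp [and_comm]
  rw [hdiff, measure_sdiff (Set.Iic_subset_Iic.2 hat.le)
    measurableSet_Iic.nullMeasurableSet (measure_ne_top _ _)]
  exact tsub_eq_zero_of_le hle

/-- Slices of an absolutely continuous measure in a nonzero direction are atomless. -/
theorem nullSingletonClass_slice {n : ℕ} {σ : Measure (Rn n)} (hac : σ ≪ volume) {v : Rn n}
    (hv : v ≠ 0) : NullSingletonClass (slice σ v) := by
  refine ⟨fun c => ?_⟩
  have hm : Measurable fun x : Rn n => ⟪x, v⟫ := by fun_prop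
  have hsurj : Function.Surjective (innerₗ (Rn n) v) := fun r =>
    ⟨(r / ⟪v, v⟫) • v, by
      rw [innerₗ_apply_apply, inner_smul_right, div_mul_cancel₀ _ (inner_self_ne_zero.2 hv)]⟩
  obtain ⟨k, -, hk⟩ := (innerₗ (Rn n) v).exists_map_addHaar_eq_smul_addHaar
    (volume : Measure (Rn n)) (volume : Measure ℝ) hsurj
  rw [slice, Measure.map_apply hm (measurableSet_singleton c)]
  refine hac ?_
  have hfun : (fun x : Rn n => ⟪x, v⟫) = innerₗ (Rn n) v := by
    ext x
    rw [innerₗ_apply_apply, real_inner_comm]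
  rw [← Measure.map_apply hm (measurableSet_singleton c), hfun, hk]
  simp

/-- Slicing the pushforward by a compatible map pushes the slice forward by its component. -/
theorem slice_map_of_inner_eq {n : ℕ} (σ : Measure (Rn n)) {T : Rn n → Rn n} (hT : Measurable T)
    {v : Rn n} {g : ℝ → ℝ} (hg : Measurable g) (h : ∀ x, ⟪T x, v⟫ = g ⟪x, v⟫) :
    slice (σ.map T) v = (slice σ v).map g := by
  rw [slice, slice, Measure.map_map (by fun_prop) hT, Measure.map_map hg (by fun_prop)]
  exact congrArg (σ.map ·) (funext h)

/-- Exact recovery of `P`-compatible maps with one step of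
`P`-matrix-slice matching: if `μ = T_♯σ` with `T ∈ 𝔖(P)`, then `T_{σ,μ;P} = T` σ-a.e.
and `(T_{σ,μ;P})_♯σ = μ`. -/
theorem stmt5 {n : ℕ}
    (σ : Measure (Rn n)) [IsProbabilityMeasure σ] (hac : σ ≪ volume)
    (hσ2 : Integrable (fun x => ‖x‖ ^ 2) σ)
    (θ : Fin n → Rn n) (hθ : Orthonormal ℝ θ)
    (f : Fin n → ℝ → ℝ) (hf : ∀ i, Monotone (f i))
    (T : Rn n → Rn n) (hT : ∀ x, T x = ∑ i, f i ⟪x, θ i⟫ • θ i)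
    (hμ2 : Integrable (fun y => ‖y‖ ^ 2) (σ.map T)) :
    smMap σ (σ.map T) θ =ᵐ[σ] T ∧
    σ.map (smMap σ (σ.map T) θ) = σ.map T := by
  have hTm : Measurable T := by
    rw [funext hT]
    refine Finset.measurable_sum _ fun i _ => ?_
    exact ((hf i).measurable.comp (by fun_prop)).smul_const (θ i)
  have hinner : ∀ i x, ⟪T x, θ i⟫ = f i ⟪x, θ i⟫ := by
    intro i x
    rw [hT, hθ.inner_left_fintype]
    simp
  have hae : smMap σ (σ.map T) θ =ᵐ[σ] T := by
    have hi : ∀ i, ∀ᵐ x ∂σ,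
        otMap1d (slice σ (θ i)) (slice (σ.map T) (θ i)) ⟪x, θ i⟫ = f i ⟪x, θ i⟫ := by
      intro i
      have hm : Measurable fun x : Rn n => ⟪x, θ i⟫ := by fun_prop
      have := nullSingletonClass_slice hac (hθ.ne_zero i)
      have : IsFiniteMeasure (slice σ (θ i)) := by
        unfold slice
        infer_instance
      rw [slice_map_of_inner_eq σ hTm (hf i).measurable (hinner i)]
      exact ae_of_ae_map hm.aemeasurable (otMap1d_map_ae_eq (slice σ (θ i)) (hf i))
    filter_upwards [ae_all_iff.2 hi] with x hx
    rw [hT, smMap]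
    exact Finset.sum_congr rfl fun i _ => by rw [hx i]
  exact ⟨hae, Measure.map_congr hae⟩

end SliceMatching
end
end
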